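/- Let Γ be a finite balanced 3-valent graph with balancing function B valued in Z_2 ⊕ Z_2. Then the number of vertices of Γ whose multiplicity is minimal among all vertices of Γ is even. -/

import Mathlib

noncomputable def pdet (u v : ℤ_[2] × ℤ_[2]) : ℤ_[2] := u.1 * v.2 - u.2 * v.1

def PrimVec (u : ℤ_[2] × ℤ_[2]) : Prop := IsUnit u.1 ∨ IsUnit u.2

theorem PadicInt.exists_bit (t : ℤ_[2]) :
    ∃ d s : ℤ_[2], (d = 0 ∨ d = 1) ∧ t = d + 2 * s := by
  obtain ⟨n, hn, h⟩ := PadicInt.exists_mem_range (p := 2) t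
  rw [PadicInt.maximalIdeal_eq_span_p, Ideal.mem_span_singleton] at h
  obtain ⟨s, hs⟩ := h
  refine ⟨n, s, ?_, ?_⟩
  · interval_cases n <;> simp
  · push_cast at hs
    linear_combination hs

theorem PadicInt.not_two_dvd_one : ¬ (2 : ℤ_[2]) ∣ 1 := by
  intro h
  exact PadicInt.prime_p (p := 2) |>.not_dvd_one (by exact_mod_cast h)

theorem PadicInt.two_dvd_sub_one {u : ℤ_[2]} (hu : ¬ 2 ∣ u) : 2 ∣ u - 1 := by
  obtain ⟨d, s, rfl | rfl, rfl⟩ := PadicInt.exists_bit u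
  · exact absurd ⟨s, by ring⟩ hu
  · exact ⟨s, by ring⟩

theorem PadicInt.exists_two_pow_mul {x : ℤ_[2]} (hx : x ≠ 0) :
    ∃ (n : ℕ) (u : ℤ_[2]), ¬ 2 ∣ u ∧ x = 2 ^ n * u := by
  refine ⟨x.valuation, PadicInt.unitCoeff hx, fun h => ?_, ?_⟩
  · exact PadicInt.not_two_dvd_one (h.trans (Units.isUnit _).dvd)
  · have := PadicInt.unitCoeff_spec hx
    push_cast at this
    rw [mul_comm]
    exact this

theorem PadicInt.two_pow_dvd_mul {n : ℕ} {u a : ℤ_[2]} (hu : ¬ 2 ∣ u) :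
    2 ^ n ∣ u * a ↔ 2 ^ n ∣ a := by
  have h2 : Prime (2 : ℤ_[2]) := by exact_mod_cast PadicInt.prime_p (p := 2)
  exact ⟨fun h => h2.pow_dvd_of_dvd_mul_left n hu h, fun h => h.mul_left u⟩

open Classical in
/-- Up to precision `L`, keeping only the even-position binary digits halves valuations of
differences. -/
theorem PadicInt.exists_even_digits (L : ℕ) : ∃ h : ℤ_[2] → ℤ_[2], ∀ n < L, ∀ t t' : ℤ_[2],
    2 ^ (2 * n) ∣ t - t' →
    2 ^ (n + 1) ∣ h t - h t' - 2 ^ n * (if 2 ^ (2 * n + 1) ∣ t - t' then 0 else 1) := by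
  choose d s hd hs using PadicInt.exists_bit
  have two_ne : (2 : ℤ_[2]) ≠ 0 := two_ne_zero
  have hds : ∀ t t', 2 ∣ t - t' → d t = d t' := by
    rintro t t' ⟨c, hc⟩
    have h1 := hs t
    have h2 := hs t'
    rcases hd t with h | h <;> rcases hd t' with h' | h' <;> rw [h, h'] <;> rw [h] at h1 <;>
      rw [h'] at h2 <;> exfalso <;> apply PadicInt.not_two_dvd_one
    · exact ⟨s t - s t' - c, by linear_combination h1 - h2 - hc⟩
    · exact ⟨c - s t + s t', by linear_combination hc - h1 + h2⟩
  have hdiff : ∀ t t', d t = d t' → t - t' = 2 * (s t - s t') := fun t t' h => by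
    linear_combination hs t - hs t' + h
  induction L with
  | zero => exact ⟨0, by simp⟩
  | succ L ih =>
    obtain ⟨h, hh⟩ := ih
    refine ⟨fun t => d t + 2 * h (s (s t)), fun n hn t t' htt => ?_⟩
    rcases n with _ | n
    · simp only [mul_zero, zero_add, pow_one, pow_zero, one_mul]
      split_ifs with h2
      · exact ⟨h (s (s t)) - h (s (s t')), by linear_combination hds t t' h2⟩
      · have h1 : 2 ∣ t - t' - 1 := PadicInt.two_dvd_sub_one h2
        obtain ⟨c, hc⟩ := h1
        exact ⟨h (s (s t)) - h (s (s t')) + c - s t + s t', by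
          linear_combination hc - hs t + hs t'⟩
    · have e1 : d t = d t' :=
        hds t t' ((dvd_pow_self 2 (by omega : 2 * (n + 1) ≠ 0)).trans htt)
      have f1 := hdiff t t' e1
      rw [f1, show 2 * (n + 1) = (2 * n + 1) + 1 by ring, pow_succ', mul_dvd_mul_iff_left two_ne]
        at htt
      have e2 : d (s t) = d (s t') := hds _ _ ((dvd_pow_self 2 (by omega)).trans htt)
      have f2 := hdiff _ _ e2
      rw [f2, pow_succ', mul_dvd_mul_iff_left two_ne] at htt
      have key := hh n (by omega) _ _ htt
      rw [f1, f2, show 2 * (n + 1) + 1 = (2 * n + 1) + 1 + 1 by ring, pow_succ' _ (2 * n + 1 + 1),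
        pow_succ' _ (2 * n + 1), mul_dvd_mul_iff_left two_ne, mul_dvd_mul_iff_left two_ne]
      obtain ⟨c, hc⟩ := key
      exact ⟨c, by linear_combination 2 * hc + e1⟩

/-- Three elements summing to zero, not all zero, become one even and two odd elements after
dividing by a power of two. -/
theorem PadicInt.exists_scale_of_add_eq_zero (N : ℕ) : ∀ x₁ x₂ x₃ : ℤ_[2], x₁ + x₂ + x₃ = 0 →
    ¬ (2 ^ N ∣ x₁ ∧ 2 ^ N ∣ x₂) →
    ∃ (i : ℕ) (w₁ w₂ w₃ : ℤ_[2]), w₁ + w₂ + w₃ = 0 ∧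
      x₁ = 2 ^ i * w₁ ∧ x₂ = 2 ^ i * w₂ ∧ x₃ = 2 ^ i * w₃ ∧
      ((¬ 2 ∣ w₁ ∧ ¬ 2 ∣ w₂) ∨ (¬ 2 ∣ w₂ ∧ ¬ 2 ∣ w₃) ∨ (¬ 2 ∣ w₃ ∧ ¬ 2 ∣ w₁)) := by
  induction N with
  | zero => intro x₁ x₂ x₃ _ h; simp at h
  | succ N ih =>
    intro x₁ x₂ x₃ hx h
    by_cases h1 : 2 ∣ x₁
    · by_cases h2 : 2 ∣ x₂
      · obtain ⟨a, rfl⟩ := h1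
        obtain ⟨b, rfl⟩ := h2
        rw [pow_succ', mul_dvd_mul_iff_left two_ne_zero, mul_dvd_mul_iff_left two_ne_zero] at h
        obtain ⟨i, w₁, w₂, w₃, hw, ha, hb, hc, hodd⟩ := ih a b (-a - b) (by ring) h
        exact ⟨i + 1, w₁, w₂, w₃, hw, by rw [ha]; ring, by rw [hb]; ring,
          by linear_combination hx + 2 * hc, hodd⟩
      · refine ⟨0, x₁, x₂, x₃, hx, by simp, by simp, by simp, Or.inr (Or.inl ⟨h2, fun h3 => h2 ?_⟩)⟩
        have : x₂ = -(x₁ + x₃) := by linear_combination hx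
        rw [this]
        exact (h1.add h3).neg_right
    · by_cases h2 : 2 ∣ x₂
      · refine ⟨0, x₁, x₂, x₃, hx, by simp, by simp, by simp, Or.inr (Or.inr ⟨fun h3 => h1 ?_, h1⟩)⟩
        have : x₁ = -(x₂ + x₃) := by linear_combination hx
        rw [this]
        exact (h2.add h3).neg_right
      · exact ⟨0, x₁, x₂, x₃, hx, by simp, by simp, by simp, Or.inl ⟨h1, h2⟩⟩

section Vertex

open Classical

variable {N M k : ℕ} {h : ℤ_[2] → ℤ_[2]} {τ : ℤ_[2] × ℤ_[2] → ℤ_[2]}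

theorem vertex_dvd_of_odd (hMk : M + k = 2 * N)
    (hh : ∀ n < N + 1, ∀ t t' : ℤ_[2], 2 ^ (2 * n) ∣ t - t' →
      2 ^ (n + 1) ∣ h t - h t' - 2 ^ n * (if 2 ^ (2 * n + 1) ∣ t - t' then 0 else 1))
    {p₁ p₂ p₃ : ℤ_[2] × ℤ_[2]} (hp : p₁ + p₂ + p₃ = 0)
    (hN : ∀ p ∈ [p₁, p₂, p₃], p.1 ≠ 0 → p.1 ∣ 2 ^ N ∧ τ p * p.1 = 2 ^ M * p.2)
    (hk : 2 ^ k ∣ pdet p₁ p₂) {i : ℕ} {w₁ w₂ : ℤ_[2]}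
    (h1 : p₁.1 = 2 ^ i * w₁) (h2 : p₂.1 = 2 ^ i * w₂) (hw₁ : ¬ 2 ∣ w₁) (hw₂ : ¬ 2 ∣ w₂) :
    2 ^ (N + 1) ∣ p₁.1 * h (τ p₁) + p₂.1 * h (τ p₂) + p₃.1 * h (τ p₃) -
      2 ^ N * (if 2 ^ (k + 1) ∣ pdet p₁ p₂ then 0 else 1) := by
  have hx : p₁.1 + p₂.1 + p₃.1 = 0 := congrArg Prod.fst hp
  have hy : p₁.2 + p₂.2 + p₃.2 = 0 := congrArg Prod.snd hp
  have two_ne : (2 : ℤ_[2]) ≠ 0 := two_ne_zero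
  have n0 : ∀ w : ℤ_[2], ¬ 2 ∣ w → 2 ^ i * w ≠ 0 := fun w hw h0 => by
    rcases mul_eq_zero.1 h0 with h0 | h0
    · exact pow_ne_zero _ two_ne h0
    · exact hw (h0 ▸ dvd_zero 2)
  obtain ⟨d1, e1⟩ := hN p₁ (by simp) (h1 ▸ n0 _ hw₁)
  obtain ⟨-, e2⟩ := hN p₂ (by simp) (h2 ▸ n0 _ hw₂)
  have hpow : ∀ a b : ℕ, (2 : ℤ_[2]) ^ a ∣ 2 ^ b → a ≤ b := fun a b hab =>
    (pow_dvd_pow_iff two_ne (fun hu => PadicInt.not_two_dvd_one hu.dvd)).1 hab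
  have hiN : i ≤ N := hpow _ _ ((Dvd.intro _ h1.symm).trans d1)
  obtain ⟨b, rfl⟩ := Nat.exists_eq_add_of_le hiN
  have hD : 2 ^ M * pdet p₁ p₂ = 2 ^ (2 * i) * (w₁ * (w₂ * (τ p₂ - τ p₁))) := by
    unfold pdet
    rw [h1] at e1 ⊢
    rw [h2] at e2 ⊢
    linear_combination w₂ * 2 ^ i * e1 - w₁ * 2 ^ i * e2
  have scale : ∀ n : ℕ, 2 ^ (k + n) ∣ pdet p₁ p₂ ↔ 2 ^ (2 * b + n) ∣ τ p₂ - τ p₁ := fun n => by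
    rw [← mul_dvd_mul_iff_left (pow_ne_zero M two_ne), hD, ← pow_add,
      show M + (k + n) = 2 * i + (2 * b + n) by omega, pow_add _ (2 * i),
      mul_dvd_mul_iff_left (pow_ne_zero _ two_ne), PadicInt.two_pow_dvd_mul hw₁,
      PadicInt.two_pow_dvd_mul hw₂]
  have key := hh b (by omega) (τ p₂) (τ p₁) ((scale 0).1 hk)
  simp only [← scale 1] at key
  have third : 2 ^ (i + b + 1) ∣ p₃.1 * (h (τ p₃) - h (τ p₁)) := by
    by_cases h30 : p₃.1 = 0
    · simp [h30]
    obtain ⟨d3, e3⟩ := hN p₃ (by simp) h30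
    obtain ⟨l, u, hu, h3⟩ := PadicInt.exists_two_pow_mul h30
    have hl : l ≤ i + b := hpow _ _ ((Dvd.intro _ h3.symm).trans d3)
    have hil : i + 1 ≤ l := by
      by_contra hlt
      obtain ⟨c, rfl⟩ : ∃ c, i = l + c := ⟨i - l, by omega⟩
      obtain ⟨r, hr⟩ := PadicInt.two_dvd_sub_one hw₁
      obtain ⟨s, hs⟩ := PadicInt.two_dvd_sub_one hw₂
      have : (2 : ℤ_[2]) ^ l * u = 2 ^ l * (2 * (2 ^ c * -(r + s + 1))) := by
        rw [h1, h2, h3, pow_add] at hx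
        linear_combination hx - 2 ^ l * 2 ^ c * (hr + hs)
      exact hu (Dvd.intro _ (mul_left_cancel₀ (pow_ne_zero _ two_ne) this).symm)
    obtain ⟨c, rfl⟩ := Nat.exists_eq_add_of_le hil
    obtain ⟨a, ha⟩ := Nat.exists_eq_add_of_le hl
    have hD3 : 2 ^ M * pdet p₁ p₂ = 2 ^ (2 * i + 1 + c) * (w₁ * (u * (τ p₁ - τ p₃))) := by
      have : pdet p₁ p₂ = p₁.2 * p₃.1 - p₁.1 * p₃.2 := by
        unfold pdet
        linear_combination p₁.1 * hy - p₁.2 * hx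
      rw [this]
      rw [h1] at e1 ⊢
      rw [h3] at e3 ⊢
      rw [show 2 * i + 1 + c = i + (i + 1 + c) by ring, pow_add _ i]
      linear_combination w₁ * 2 ^ i * e3 - u * 2 ^ (i + 1 + c) * e1
    have h2N : 2 ^ (2 * a + 1 + c) ∣ τ p₁ - τ p₃ := by
      have := mul_dvd_mul_left (2 ^ M) hk
      rwa [hD3, ← pow_add, show M + k = (2 * i + 1 + c) + (2 * a + 1 + c) by omega,
        pow_add _ (2 * i + 1 + c), mul_dvd_mul_iff_left (pow_ne_zero _ two_ne),
        PadicInt.two_pow_dvd_mul hw₁, PadicInt.two_pow_dvd_mul hu] at this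
    have h2N' : 2 ^ (2 * a + 1) ∣ τ p₃ - τ p₁ :=
      (pow_dvd_pow 2 (by omega)).trans (dvd_sub_comm.1 h2N)
    have := hh a (by omega) (τ p₃) (τ p₁) ((pow_dvd_pow 2 (by omega)).trans h2N')
    rw [if_pos h2N', mul_zero, sub_zero] at this
    rw [h3, ha, add_assoc (i + 1 + c), pow_add]
    exact mul_dvd_mul (Dvd.intro _ rfl) this
  obtain ⟨r, hr⟩ := key
  obtain ⟨q, hq⟩ := third
  obtain ⟨s, hs⟩ := PadicInt.two_dvd_sub_one hw₂
  set δ : ℤ_[2] := if 2 ^ (k + 1) ∣ pdet p₁ p₂ then 0 else 1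
  have hx1 : p₁.1 = -p₂.1 - p₃.1 := by linear_combination hx
  refine ⟨w₂ * r + q + δ * s, ?_⟩
  rw [hx1, h2, pow_succ, pow_add]
  rw [pow_succ] at hr
  rw [pow_succ, pow_add] at hq
  linear_combination hq + 2 ^ i * w₂ * hr + 2 ^ i * 2 ^ b * δ * hs

theorem vertex_dvd (hMk : M + k = 2 * N)
    (hh : ∀ n < N + 1, ∀ t t' : ℤ_[2], 2 ^ (2 * n) ∣ t - t' →
      2 ^ (n + 1) ∣ h t - h t' - 2 ^ n * (if 2 ^ (2 * n + 1) ∣ t - t' then 0 else 1))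
    {p₁ p₂ p₃ : ℤ_[2] × ℤ_[2]} (hp : p₁ + p₂ + p₃ = 0)
    (hN : ∀ p ∈ [p₁, p₂, p₃], p.1 ≠ 0 → p.1 ∣ 2 ^ N ∧ τ p * p.1 = 2 ^ M * p.2)
    (hk : 2 ^ k ∣ pdet p₁ p₂) :
    2 ^ (N + 1) ∣ p₁.1 * h (τ p₁) + p₂.1 * h (τ p₂) + p₃.1 * h (τ p₃) -
      2 ^ N * (if 2 ^ (k + 1) ∣ pdet p₁ p₂ then 0 else 1) := by
  have hx : p₁.1 + p₂.1 + p₃.1 = 0 := congrArg Prod.fst hp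
  have hy : p₁.2 + p₂.2 + p₃.2 = 0 := congrArg Prod.snd hp
  by_cases hdiv : 2 ^ (N + 1) ∣ p₁.1 ∧ 2 ^ (N + 1) ∣ p₂.1
  · have hz : ∀ p ∈ [p₁, p₂, p₃], 2 ^ (N + 1) ∣ p.1 → p.1 = 0 := fun p hp hd => by
      by_contra h0
      have := (pow_dvd_pow_iff two_ne_zero (fun hu => PadicInt.not_two_dvd_one hu.dvd)).1
        (hd.trans (hN p hp h0).1)
      omega
    have h1 := hz p₁ (by simp) hdiv.1
    have h2 := hz p₂ (by simp) hdiv.2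
    have h3 : p₃.1 = 0 := by simpa [h1, h2] using hx
    simp [pdet, h1, h2, h3]
  obtain ⟨i, w₁, w₂, w₃, -, h1, h2, h3, ⟨a, b⟩ | ⟨a, b⟩ | ⟨a, b⟩⟩ :=
    PadicInt.exists_scale_of_add_eq_zero (N + 1) _ _ _ hx hdiv
  · exact vertex_dvd_of_odd hMk hh hp hN hk h1 h2 a b
  · have e : pdet p₁ p₂ = pdet p₂ p₃ := by
      unfold pdet
      linear_combination p₂.2 * hx - p₂.1 * hy
    rw [e] at hk ⊢
    have := vertex_dvd_of_odd hMk hh (p₁ := p₂) (p₂ := p₃) (p₃ := p₁) (by rw [← hp]; abel)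
      (fun p hp => hN p (by simp at hp ⊢; tauto)) hk h2 h3 a b
    convert this using 1
    ring
  · have e : pdet p₁ p₂ = pdet p₃ p₁ := by
      unfold pdet
      linear_combination p₁.1 * hy - p₁.2 * hx
    rw [e] at hk ⊢
    have := vertex_dvd_of_odd hMk hh (p₁ := p₃) (p₂ := p₁) (p₃ := p₂) (by rw [← hp]; abel)
      (fun p hp => hN p (by simp at hp ⊢; tauto)) hk h3 h1 a b
    convert this using 1
    ring

end Vertex

/-- An odd function on the balancing vectors cancels along each edge. -/
theorem sum_eq_zero_of_odd {E : Type*} [Fintype E] {rev : E → E} (hrev : ∀ e, rev (rev e) = e)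
    {F : E → ℤ_[2]} (hF : ∀ e, F (rev e) = -F e) : ∑ e, F e = 0 := by
  have h := Equiv.sum_comp (Function.Involutive.toPerm rev hrev) F
  simp only [Function.Involutive.toPerm, Equiv.coe_fn_mk, hF, Finset.sum_neg_distrib] at h
  exact self_eq_neg.1 h.symm

theorem PadicInt.exists_dvd_two_pow {E : Type*} [Fintype E] (x : E → ℤ_[2]) :
    ∃ n : ℕ, ∀ e, x e ≠ 0 → x e ∣ 2 ^ n := by
  have hone : ∀ e, ∃ n : ℕ, x e ≠ 0 → x e ∣ 2 ^ n := fun e => by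
    by_cases h : x e = 0
    · exact ⟨0, fun h' => absurd h h'⟩
    · refine ⟨(x e).valuation, fun _ => ?_⟩
      have := PadicInt.unitCoeff_spec h
      push_cast at this
      exact ⟨((PadicInt.unitCoeff h)⁻¹ : ℤ_[2]ˣ), by
        nth_rw 2 [this]
        rw [mul_right_comm, Units.mul_inv, one_mul]⟩
  choose n hn using hone
  exact ⟨∑ e, n e, fun e he => (hn e he).trans
    (pow_dvd_pow 2 (Finset.single_le_sum (fun _ _ => Nat.zero_le _) (Finset.mem_univ e)))⟩

open Finset in
theorem stmt17 {V E : Type} [Fintype V] [Fintype E] [DecidableEq V] [DecidableEq E]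
    (rev : E → E) (head : E → V) (B : E → ℤ_[2] × ℤ_[2])
    (hrev : ∀ e, rev (rev e) = e) (hrevne : ∀ e, rev e ≠ e)
    (hcubic : ∀ v : V, (Finset.univ.filter fun e => head e = v).card = 3)
    (hBrev : ∀ e, B (rev e) = - B e)
    (hBsum : ∀ v : V, ∑ e ∈ Finset.univ.filter (fun e => head e = v), B e = 0)
    (m : V → ℕ∞)
    (hm : ∀ (v : V) (e1 e2 : E), e1 ≠ e2 → head e1 = v → head e2 = v →
      m v = emultiplicity (2 : ℤ_[2]) (pdet (B e1) (B e2))) :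
    Even ((Finset.univ.filter fun v : V => ∀ w : V, m v ≤ m w).card) := by
  classical
  rcases isEmpty_or_nonempty V with hV | hV
  · simp
  obtain ⟨v₀, hv₀⟩ := Finite.exists_min m
  have triple : ∀ v, ∃ e₁ e₂ e₃ : E, e₁ ≠ e₂ ∧ head e₁ = v ∧ head e₂ = v ∧
      B e₁ + B e₂ + B e₃ = 0 ∧ ∀ F : E → ℤ_[2],
        ∑ e ∈ univ.filter (fun e => head e = v), F e = F e₁ + F e₂ + F e₃ := fun v => by
    obtain ⟨e₁, e₂, e₃, h12, h13, h23, hs⟩ := Finset.card_eq_three.1 (hcubic v)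
    have mem : ∀ e, e ∈ ({e₁, e₂, e₃} : Finset E) → head e = v := fun e he => by
      rw [← hs] at he
      exact (mem_filter.1 he).2
    have hsum : ∀ {A : Type} [AddCommMonoid A] (F : E → A),
        ∑ e ∈ univ.filter (fun e => head e = v), F e = F e₁ + F e₂ + F e₃ := fun F => by
      rw [hs, sum_insert (by simp [h12, h13]), sum_insert (by simp [h23]), sum_singleton,
        add_assoc]
    exact ⟨e₁, e₂, e₃, h12, mem _ (by simp), mem _ (by simp),
      by rw [← hsum, hBsum v], fun F => hsum F⟩
  have filter_eq : (univ.filter fun v : V => ∀ w : V, m v ≤ m w) =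
      univ.filter fun v => m v = m v₀ := by
    ext v
    simp only [mem_filter, mem_univ, true_and]
    exact ⟨fun h => le_antisymm (h v₀) (hv₀ v), fun h w => h ▸ hv₀ w⟩
  rw [filter_eq]
  cases hk : m v₀ with
  | top =>
    have hall : (univ.filter fun v => m v = ⊤) = univ := by
      ext v
      simpa using top_le_iff.1 (hk ▸ hv₀ v)
    rw [hall]
    have hE : Even (card (univ : Finset E)) := by
      have : ∑ _e : E, (1 : ZMod 2) = 0 :=
        Finset.sum_involution (fun e _ => rev e) (fun _ _ => by decide)
          (fun e _ _ => hrevne e) (fun _ _ => mem_univ _) (fun e _ => hrev e)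
      rw [sum_const, nsmul_one] at this
      exact (ZMod.natCast_eq_zero_iff_even).1 this
    rw [card_eq_sum_card_fiberwise (f := head) (t := univ) (fun _ _ => mem_univ _)] at hE
    simp only [hcubic, sum_const, smul_eq_mul] at hE
    rcases Nat.even_mul.1 hE with h | h
    · exact h
    · exact absurd h (by decide)
  | coe k =>
    obtain ⟨n, hn⟩ := PadicInt.exists_dvd_two_pow fun e => (B e).1
    set N := n + k
    set M := 2 * n + k
    obtain ⟨h, hh⟩ := PadicInt.exists_even_digits (N + 1)
    have hτ : ∀ p : ℤ_[2] × ℤ_[2], ∃ t : ℤ_[2], p.1 ∣ 2 ^ M → t * p.1 = 2 ^ M * p.2 := fun p => by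
      by_cases hp : p.1 ∣ 2 ^ M
      · obtain ⟨c, hc⟩ := hp
        exact ⟨c * p.2, fun _ => by rw [hc]; ring⟩
      · exact ⟨0, fun h => absurd h hp⟩
    choose τ hτ using hτ
    have hBτ : ∀ e, (B e).1 ≠ 0 → (B e).1 ∣ 2 ^ N ∧ τ (B e) * (B e).1 = 2 ^ M * (B e).2 :=
      fun e he => ⟨(hn e he).trans (pow_dvd_pow 2 (by omega)),
        hτ _ ((hn e he).trans (pow_dvd_pow 2 (by omega)))⟩
    have htotal : ∑ e, (B e).1 * h (τ (B e)) = 0 := by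
      refine sum_eq_zero_of_odd hrev fun e => ?_
      by_cases h0 : (B e).1 = 0
      · simp [hBrev, h0]
      have h1 := (hBτ e h0).2
      have h2 := (hBτ (rev e) (by simpa [hBrev] using h0)).2
      rw [hBrev] at h2
      simp only [Prod.fst_neg, Prod.snd_neg] at h2
      have : τ (-B e) = τ (B e) := mul_right_cancel₀ h0 (by linear_combination -h1 - h2)
      rw [hBrev, this, Prod.fst_neg, neg_mul]
    have hvertex : ∀ v, (2 : ℤ_[2]) ^ (N + 1) ∣
        ∑ e ∈ univ.filter (fun e => head e = v), (B e).1 * h (τ (B e)) -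
          2 ^ N * (if m v = k then 1 else 0) := fun v => by
      obtain ⟨e₁, e₂, e₃, h12, hv1, hv2, hzero, hsum⟩ := triple v
      have hmv := hm v e₁ e₂ h12 hv1 hv2
      have hkv : (k : ℕ∞) ≤ m v := hk ▸ hv₀ v
      have hdvd : 2 ^ k ∣ pdet (B e₁) (B e₂) := pow_dvd_of_le_emultiplicity (hmv ▸ hkv)
      have hiff : m v = k ↔ ¬ 2 ^ (k + 1) ∣ pdet (B e₁) (B e₂) := by
        rw [hmv, emultiplicity_eq_coe]
        exact and_iff_right hdvd
      have := vertex_dvd (τ := τ) (M := M) (by omega) hh hzero (fun p hp => by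
        simp only [List.mem_cons, List.not_mem_nil, or_false] at hp
        rcases hp with rfl | rfl | rfl <;> exact hBτ _) hdvd
      rw [hsum]
      simp only [hiff, ite_not]
      exact this
    have hdvd := dvd_sum fun v (_ : v ∈ univ) => hvertex v
    rw [sum_sub_distrib, sum_fiberwise, htotal, ← mul_sum, sum_boole, zero_sub, dvd_neg,
      pow_succ, mul_dvd_mul_iff_left (pow_ne_zero _ two_ne_zero)] at hdvd
    by_contra hodd
    obtain ⟨r, hr⟩ := Nat.not_even_iff_odd.1 hodd
    rw [hr] at hdvd
    push_cast at hdvd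
    exact PadicInt.not_two_dvd_one ((dvd_add_right (Dvd.intro _ rfl)).1 hdvd)
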